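/- Second difference equation (7-point eigenvalue equation in the variables): for every real q with 0 < q < 1, every positive integer N, all nonzero real numbers θ, φ, all integers n₁, n₂ ≥ 0 with n₁+n₂ ≤ N, and all integers x₁, x₂ ≥ 0 with x₁+x₂ ≤ N, writing K(y₁,y₂) := K_{n₁,n₂}(y₁,y₂;θ,φ;N), one has q^{n₁+n₂} K(x₁,x₂) = [q^{x₁+x₂}(1-(1+q^{-1})φ² q^{x₁+x₂-N}+φ²) + q^{-1}φ² q^{2x₁+x₂-N}(1-(1+q^{-1})θ² q^{-x₂}+θ²+q^{-1}θ² q^{-(x₁+x₂)})] K(x₁,x₂) + φ² q^{x₁+x₂-N-1}(1-q^{x₁})(1-θ² q^{-x₂-1}) K(x₁-1,x₂+1) + θ²φ² q^{2x₁-N-1}(1-q^{x₂}) K(x₁+1,x₂-1) + q^{x₁}(1-q^{x₂})(1-φ² q^{x₁+x₂-N-1}) K(x₁,x₂-1) - φ² q^{x₁+x₂}(1-q^{x₁+x₂-N})(1-θ² q^{-x₂-1}) K(x₁,x₂+1) + (1-q^{x₁})(1-φ² q^{x₁+x₂-N-1}) K(x₁-1,x₂) - θ²φ² q^{x₁-1}(1-q^{x₁+x₂-N})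 K(x₁+1,x₂). -/

import Mathlib

open Finset

/-- The q-Pochhammer symbol `(a;q)_n = ∏_{k=0}^{n-1} (1 - a q^k)`. -/
noncomputable def qPoch (q a : ℝ) (n : ℕ) : ℝ := ∏ k ∈ Finset.range n, (1 - a * q ^ k)

/-- The quantum q-Krawtchouk polynomial `k_n(x;p,N;q)`, defined for all integers `x, N`. -/
noncomputable def qKraw (q : ℝ) (n : ℕ) (x N : ℤ) (p : ℝ) : ℝ :=
  (-1 : ℝ) ^ n * q ^ (n * (n - 1) / 2) *
    ∑ k ∈ Finset.range (n + 1),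
      qPoch q (q ^ (-(n : ℤ))) k * qPoch q (q ^ (-x)) k *
        qPoch q (q ^ ((k : ℤ) - N)) (n - k) / qPoch q q k * (p * q ^ (n + 1)) ^ k

/-- The bivariate quantum q-Krawtchouk polynomial of Gasper and Rahman,
`K_{n₁,n₂}(x₁,x₂;θ,φ;N) = k_{n₁}(x₁;θ^{-2},x₁+x₂;q) k_{n₂}(x₁+x₂-n₁;φ^{-2},N-n₁;q)`,
with the convention that it vanishes when a degree index is negative. -/
noncomputable def Kq (q : ℝ) (n₁ n₂ x₁ x₂ : ℤ) (θ φ : ℝ) (N : ℤ) : ℝ :=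
  if 0 ≤ n₁ ∧ 0 ≤ n₂ then
    qKraw q n₁.toNat x₁ (x₁ + x₂) (θ ^ 2)⁻¹ *
      qKraw q n₂.toNat (x₁ + x₂ - n₁) (N - n₁) (φ ^ 2)⁻¹
  else 0

/-- The q-trinomial coefficient `[N; x₁, x₂]_q`. -/
noncomputable def qTrinom (q : ℝ) (N x₁ x₂ : ℕ) : ℝ :=
  qPoch q q N / (qPoch q q x₁ * qPoch q q x₂ * qPoch q q (N - x₁ - x₂))

/-- The orthogonality weight `Δ^{(N)}_{x₁,x₂}(θ,φ)`. -/
noncomputable def Δw (q : ℝ) (N x₁ x₂ : ℕ) (θ φ : ℝ) : ℝ :=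
  (-1 : ℝ) ^ (N - x₁) * (θ ^ 2 * q⁻¹) ^ (x₁ + x₂) * q ^ (x₁ * (x₁ - 1) / 2) *
    qTrinom q N x₁ x₂ * qPoch q ((θ ^ 2)⁻¹ * q) x₂ * qPoch q ((φ ^ 2)⁻¹ * q) (N - x₁ - x₂) *
    φ ^ (2 * N) * q ^ (-((N : ℤ) * (N + 1) / 2))

/-- The normalization constant `H^{(N)}_{n₁,n₂}(θ,φ)`. -/
noncomputable def Hn (q : ℝ) (N n₁ n₂ : ℕ) (θ φ : ℝ) : ℝ :=
  (-1 : ℝ) ^ (n₁ + n₂) * qPoch q (q * (θ ^ 2)⁻¹) n₁ * qPoch q (q * (φ ^ 2)⁻¹) n₂ *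
    φ ^ (2 * n₁) * (qPoch q q N / qPoch q q (N - n₁ - n₂)) ^ 2 * (qTrinom q N n₁ n₂)⁻¹ *
    q ^ (3 * ((n₁ : ℤ) * (n₁ - 1)) / 2 + 3 * ((n₂ : ℤ) * (n₂ - 1)) / 2 +
          (n₁ : ℤ) * n₂ - (N : ℤ) * (n₁ + n₂) - 2 * n₁ - n₂)

/-- The dual weight `Δ̃^{(N)}_{n₁,n₂}(θ,φ)`. -/
noncomputable def Δdual (q : ℝ) (N n₁ n₂ : ℕ) (θ φ : ℝ) : ℝ :=
  (-1 : ℝ) ^ (n₁ + n₂) * q ^ (-((n₁ : ℤ) * (n₁ - 1)) - (n₂ : ℤ) * (n₂ - 1)) *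
    φ ^ (-(2 * (n₁ : ℤ))) * (qPoch q q (N - n₁ - n₂) / qPoch q q N) ^ 2 * qTrinom q N n₁ n₂ *
    q ^ ((N : ℤ) * (n₁ + n₂) + 2 * n₁ + n₂ - (n₁ : ℤ) * n₂ -
          (n₁ : ℤ) * (n₁ - 1) / 2 - (n₂ : ℤ) * (n₂ - 1) / 2) /
    (qPoch q (q * (θ ^ 2)⁻¹) n₁ * qPoch q (q * (φ ^ 2)⁻¹) n₂)

theorem qPoch_zero (q a : ℝ) : qPoch q a 0 = 1 := by
  simp [qPoch]

theorem qPoch_succ (q a : ℝ) (n : ℕ) :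
    qPoch q a (n + 1) = qPoch q a n * (1 - a * q ^ n) := by
  simp [qPoch, Finset.prod_range_succ]

theorem qPoch_succ' (q a : ℝ) (n : ℕ) :
    qPoch q a (n + 1) = (1 - a) * qPoch q (a * q) n := by
  simp only [qPoch, Finset.prod_range_succ', pow_zero, mul_one]
  rw [mul_comm]
  congr 1
  exact Finset.prod_congr rfl fun k _ => by ring

/-- The shift `a ↦ a q` only changes the two extreme factors of `(a;q)_n`. -/
theorem one_sub_mul_qPoch_shift (q a : ℝ) (n : ℕ) :
    (1 - a) * qPoch q (a * q) n = qPoch q a n * (1 - a * q ^ n) := by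
  rw [← qPoch_succ', qPoch_succ]

/-- The `k`-th coefficient `(q^{-n};q)_k / (q;q)_k (p q^{n+1})^k`. -/
noncomputable def qKrawCoeff (q : ℝ) (n : ℕ) (p : ℝ) (k : ℕ) : ℝ :=
  qPoch q (q ^ (-(n : ℤ))) k / qPoch q q k * (p * q ^ (n + 1)) ^ k

/-- The sum defining the quantum q-Krawtchouk polynomial, with `Y = q^{-x}` and `Z = q^{-N}`. -/
noncomputable def qKrawSum (q : ℝ) (n : ℕ) (p Y Z : ℝ) : ℝ :=
  ∑ k ∈ Finset.range (n + 1), qKrawCoeff q n p k * qPoch q Y k * qPoch q (Z * q ^ k) (n - k)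

theorem qKraw_eq (q : ℝ) (hq0 : 0 < q) (n : ℕ) (x N : ℤ) (p : ℝ) :
    qKraw q n x N p = (-1 : ℝ) ^ n * q ^ (n * (n - 1) / 2) *
      qKrawSum q n p (q ^ (-x)) (q ^ (-N)) := by
  unfold qKraw qKrawSum qKrawCoeff
  congr 1
  refine Finset.sum_congr rfl fun k _ => ?_
  rw [show q ^ ((k : ℤ) - N) = q ^ (-N) * q ^ k by
    rw [← zpow_natCast q k, ← zpow_add₀ hq0.ne']; ring_nf]
  ring

theorem one_sub_pow_succ_ne_zero {q : ℝ} (hq0 : 0 < q) (hq1 : q < 1) (k : ℕ) :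
    1 - q * q ^ k ≠ 0 := by
  rw [← pow_succ']
  exact (sub_pos.2 (pow_lt_one₀ hq0.le hq1 k.succ_ne_zero)).ne'

theorem qKrawCoeff_succ {q : ℝ} (hq0 : 0 < q) (hq1 : q < 1) (n : ℕ) (p : ℝ) (k : ℕ) :
    qKrawCoeff q n p (k + 1) =
      qKrawCoeff q n p k * (p * q * (q ^ n - q ^ k)) / (1 - q * q ^ k) := by
  have h := one_sub_pow_succ_ne_zero hq0 hq1 k
  have hQ : q ^ n ≠ 0 := pow_ne_zero _ hq0.ne'
  have h2 : qPoch q q k ≠ 0 :=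
    Finset.prod_ne_zero_iff.2 fun j _ => one_sub_pow_succ_ne_zero hq0 hq1 j
  unfold qKrawCoeff
  rw [qPoch_succ, qPoch_succ, zpow_neg, zpow_natCast, pow_succ (p * q ^ (n + 1)) k, pow_succ q n]
  field_simp

theorem sum_range_succ_eq_of_shift {n : ℕ} {T H R : ℕ → ℝ} (h0 : T 0 = H 0) (hn : H n = R n)
    (h : ∀ k < n, T (k + 1) - H (k + 1) + H k = R k) :
    ∑ k ∈ Finset.range (n + 1), T k = ∑ k ∈ Finset.range (n + 1), R k := by
  have hE : ∑ k ∈ Finset.range (n + 1), (T k - H k) =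
      ∑ k ∈ Finset.range n, (T (k + 1) - H (k + 1)) := by
    rw [Finset.sum_range_succ', h0, sub_self, add_zero]
  have hR : ∑ k ∈ Finset.range n, (T (k + 1) - H (k + 1)) + ∑ k ∈ Finset.range n, H k =
      ∑ k ∈ Finset.range n, R k := by
    rw [← Finset.sum_add_distrib]
    exact Finset.sum_congr rfl fun k hk => h k (Finset.mem_range.1 hk)
  rw [Finset.sum_sub_distrib] at hE
  have hH := Finset.sum_range_succ H n
  have hR' := Finset.sum_range_succ R n
  linarith

/-- The q-difference equation of the quantum q-Krawtchouk polynomials. -/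
theorem qKrawSum_difference {q : ℝ} (hq0 : 0 < q) (hq1 : q < 1) (n : ℕ) (p Z : ℝ) {X Y : ℝ}
    (hXY : X * Y = 1) :
    -(X * (1 - X * Z)) * (qKrawSum q n p (Y / q) Z - qKrawSum q n p Y Z) +
      (1 - X) * (p - X * Z / q) * (qKrawSum q n p (Y * q) Z - qKrawSum q n p Y Z) +
      p * (1 - q ^ n) * qKrawSum q n p Y Z = 0 := by
  have hX : X ≠ 0 := left_ne_zero_of_mul_eq_one hXY
  obtain rfl : Y = X⁻¹ := eq_inv_of_mul_eq_one_right hXY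
  have hq := hq0.ne'
  unfold qKrawSum
  rw [← Finset.sum_sub_distrib, ← Finset.sum_sub_distrib, Finset.mul_sum, Finset.mul_sum,
    Finset.mul_sum, ← Finset.sum_add_distrib, ← Finset.sum_add_distrib]
  refine (sum_range_succ_eq_of_shift (R := fun _ => 0) (H := fun k => qKrawCoeff q n p k *
    (p * (q ^ k - q ^ n)) * qPoch q X⁻¹ k * qPoch q (Z * q ^ k) (n - k)) ?_ ?_ ?_).trans
    Finset.sum_const_zero
  · simp only [qPoch_zero, pow_zero]
    ring
  · simp
  · intro k hk
    obtain ⟨m, rfl⟩ := Nat.exists_eq_add_of_lt hk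
    have h1 := one_sub_pow_succ_ne_zero hq0 hq1 k
    have e1 : qPoch q (X⁻¹ / q) (k + 1) = (1 - X⁻¹ / q) * qPoch q X⁻¹ k := by
      rw [qPoch_succ', div_mul_cancel₀ _ hq]
    have e2 : (1 - X) * qPoch q (X⁻¹ * q) (k + 1) =
        -X * (qPoch q X⁻¹ k * (1 - X⁻¹ * q ^ k) * (1 - X⁻¹ * (q * q ^ k))) := by
      rw [← pow_succ', ← qPoch_succ, ← one_sub_mul_qPoch_shift]
      field_simp
      ring
    have e3 : qPoch q (Z * q ^ k) (m + 1) =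
        (1 - Z * q ^ k) * qPoch q (Z * (q * q ^ k)) m := by
      rw [qPoch_succ']; ring_nf
    rw [show k + m + 1 - (k + 1) = m by omega, show k + m + 1 - k = m + 1 by omega,
      qKrawCoeff_succ hq0 hq1, e1, e3, qPoch_succ q X⁻¹ k, pow_succ' q k]
    generalize qKrawCoeff q (k + m + 1) p k = c
    generalize qPoch q (Z * (q * q ^ k)) m = d at *
    generalize qPoch q X⁻¹ k = a at *
    generalize qPoch q (X⁻¹ * q) (k + 1) = b at *
    generalize q ^ (k + m + 1) = Q at *
    generalize q ^ k = K at *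
    have e2' : b * (1 - X) = -X * (a * (1 - X⁻¹ * K) * (1 - X⁻¹ * (q * K))) := by
      rw [mul_comm, e2]
    have key : ∀ r : ℝ, (1 - X) * (p - X * Z / q) * (r * b * d - r * (a * (1 - X⁻¹ * K)) * d) =
        (p - X * Z / q) * r * d * (-X * (a * (1 - X⁻¹ * K) * (1 - X⁻¹ * (q * K))) -
          (1 - X) * (a * (1 - X⁻¹ * K))) := by
      intro r
      rw [← e2']
      ring
    rw [key]
    field_simp
    ring

/-- The contiguous relation lowering `N`. -/
theorem qKrawSum_lower {q : ℝ} (n : ℕ) (p : ℝ) {X Y Z S : ℝ}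
    (hXY : X * Y = 1) (hZS : Z * S = 1) :
    (X - S) * qKrawSum q n p Y (Z * q) + (1 - X) * qKrawSum q n p (Y * q) (Z * q) =
      (q ^ n - S) * qKrawSum q n p Y Z := by
  have hX : X ≠ 0 := left_ne_zero_of_mul_eq_one hXY
  have hZ : Z ≠ 0 := left_ne_zero_of_mul_eq_one hZS
  obtain rfl : Y = X⁻¹ := eq_inv_of_mul_eq_one_right hXY
  obtain rfl : S = Z⁻¹ := eq_inv_of_mul_eq_one_right hZS
  unfold qKrawSum
  rw [Finset.mul_sum, Finset.mul_sum, Finset.mul_sum, ← Finset.sum_add_distrib]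
  refine Finset.sum_congr rfl fun k hk => ?_
  obtain ⟨m, rfl⟩ := Nat.exists_eq_add_of_le (Finset.mem_range_succ_iff.1 hk)
  rw [show k + m - k = m by omega, pow_add]
  have e1 : (1 - X) * qPoch q (X⁻¹ * q) k = -X * (qPoch q X⁻¹ k * (1 - X⁻¹ * q ^ k)) := by
    rw [← one_sub_mul_qPoch_shift]
    field_simp
    ring
  have e2 := one_sub_mul_qPoch_shift q (Z * q ^ k) m
  rw [show Z * q ^ k * q = Z * q * q ^ k by ring] at e2
  have e3 : (X - Z⁻¹) - X * (1 - X⁻¹ * q ^ k) = -Z⁻¹ * (1 - Z * q ^ k) := by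
    field_simp
    ring
  have e4 : q ^ k * q ^ m - Z⁻¹ = -Z⁻¹ * (1 - Z * q ^ k * q ^ m) := by
    field_simp
    ring
  linear_combination qKrawCoeff q (k + m) p k * qPoch q (Z * q * q ^ k) m * e1 +
    qKrawCoeff q (k + m) p k * qPoch q X⁻¹ k * qPoch q (Z * q * q ^ k) m * e3 -
    qKrawCoeff q (k + m) p k * qPoch q X⁻¹ k * qPoch q (Z * q ^ k) m * e4 -
    Z⁻¹ * qKrawCoeff q (k + m) p k * qPoch q X⁻¹ k * e2

/-- The contiguous relation raising `N`. -/
theorem qKrawSum_raise {q : ℝ} (hq0 : 0 < q) (hq1 : q < 1) (n : ℕ) {p t X Y Z S : ℝ}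
    (hpt : p * t = 1) (hXY : X * Y = 1) (hZS : Z * S = 1) :
    (S - t * X / q) * qKrawSum q n p Y (Z / q) + t * X / q * qKrawSum q n p (Y / q) (Z / q) =
      S * qKrawSum q n p Y Z := by
  have hX : X ≠ 0 := left_ne_zero_of_mul_eq_one hXY
  have hZ : Z ≠ 0 := left_ne_zero_of_mul_eq_one hZS
  have hp : p ≠ 0 := left_ne_zero_of_mul_eq_one hpt
  obtain rfl : Y = X⁻¹ := eq_inv_of_mul_eq_one_right hXY
  obtain rfl : S = Z⁻¹ := eq_inv_of_mul_eq_one_right hZS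
  obtain rfl : t = p⁻¹ := eq_inv_of_mul_eq_one_right hpt
  have hq := hq0.ne'
  unfold qKrawSum
  rw [Finset.mul_sum, Finset.mul_sum, Finset.mul_sum, ← Finset.sum_add_distrib]
  refine sum_range_succ_eq_of_shift (H := fun k => Z⁻¹ * (qKrawCoeff q n p k *
    qPoch q X⁻¹ k * qPoch q (Z / q * q ^ k) (n - k))) ?_ ?_ ?_
  · simp only [qPoch_zero]
    ring
  · simp only [Nat.sub_self, qPoch_zero]
  · intro k hk
    obtain ⟨m, rfl⟩ := Nat.exists_eq_add_of_lt hk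
    have h1 := one_sub_pow_succ_ne_zero hq0 hq1 k
    have e1 : qPoch q (X⁻¹ / q) (k + 1) = (1 - X⁻¹ / q) * qPoch q X⁻¹ k := by
      rw [qPoch_succ', div_mul_cancel₀ _ hq]
    have e3 : qPoch q (Z / q * q ^ k) (m + 1) =
        (1 - Z / q * q ^ k) * qPoch q (Z * q ^ k) m := by
      rw [qPoch_succ', show Z / q * q ^ k * q = Z * q ^ k by field_simp]
    have e4 : Z / q * q ^ (k + 1) = Z * q ^ k := by
      rw [pow_succ']; field_simp
    rw [show k + m + 1 - (k + 1) = m by omega, show k + m + 1 - k = m + 1 by omega,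
      qKrawCoeff_succ hq0 hq1, e1, e4, e3, qPoch_succ q X⁻¹ k, qPoch_succ q (Z * q ^ k) m,
      pow_succ q (k + m), pow_add]
    generalize qKrawCoeff q (k + m + 1) p k = c
    generalize qPoch q (Z * q ^ k) m = d
    generalize qPoch q X⁻¹ k = a
    generalize q ^ k = K at *
    generalize q ^ m = M
    field_simp
    ring

theorem Kq_shift (q : ℝ) (hq0 : 0 < q) (n₁ n₂ x₁ x₂ N : ℕ) (θ φ : ℝ) (i j : ℤ) :
    Kq q n₁ n₂ (x₁ + i) (x₂ + j) θ φ N =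
      (-1 : ℝ) ^ n₁ * q ^ (n₁ * (n₁ - 1) / 2) * ((-1 : ℝ) ^ n₂ * q ^ (n₂ * (n₂ - 1) / 2)) *
        (qKrawSum q n₁ (θ ^ 2)⁻¹ ((q ^ x₁)⁻¹ * q ^ (-i)) ((q ^ x₁ * q ^ x₂)⁻¹ * q ^ (-(i + j))) *
          qKrawSum q n₂ (φ ^ 2)⁻¹ (q ^ n₁ / (q ^ x₁ * q ^ x₂) * q ^ (-(i + j)))
            (q ^ n₁ / q ^ N)) := by
  have hq := hq0.ne'
  have h1 : q ^ (-((x₁ : ℤ) + i)) = (q ^ x₁)⁻¹ * q ^ (-i) := by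
    rw [neg_add, zpow_add₀ hq, zpow_neg q (x₁ : ℤ), zpow_natCast]
  have h2 : q ^ (-((x₁ : ℤ) + i + (x₂ + j))) = (q ^ x₁ * q ^ x₂)⁻¹ * q ^ (-(i + j)) := by
    rw [← pow_add, ← zpow_natCast, ← zpow_neg, ← zpow_add₀ hq]
    push_cast
    ring_nf
  have h3 : q ^ (-((x₁ : ℤ) + i + (x₂ + j) - n₁)) =
      q ^ n₁ / (q ^ x₁ * q ^ x₂) * q ^ (-(i + j)) := by
    rw [neg_sub, zpow_sub₀ hq, div_eq_mul_inv, ← zpow_neg, h2, zpow_natCast]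
    ring
  have h4 : q ^ (-((N : ℤ) - n₁)) = q ^ n₁ / q ^ N := by
    rw [neg_sub, zpow_sub₀ hq, zpow_natCast, zpow_natCast]
  simp only [Kq, Int.natCast_nonneg, and_self, if_true, Int.toNat_natCast, qKraw_eq q hq0,
    h1, h2, h3, h4]
  ring

/-- Second difference equation (7-point eigenvalue equation in the variables). -/
theorem second_difference_equation (q : ℝ) (hq0 : 0 < q) (hq1 : q < 1)
    (N : ℕ) (hN : 0 < N) (θ φ : ℝ) (hθ : θ ≠ 0) (hφ : φ ≠ 0)
    (n₁ n₂ : ℕ) (hn : n₁ + n₂ ≤ N) (x₁ x₂ : ℕ) (hx : x₁ + x₂ ≤ N) :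
    q ^ (n₁ + n₂) * Kq q n₁ n₂ x₁ x₂ θ φ N
    = (q ^ (x₁ + x₂) * (1 - (1 + q⁻¹) * φ ^ 2 * q ^ ((x₁ : ℤ) + x₂ - N) + φ ^ 2)
        + q⁻¹ * φ ^ 2 * q ^ (2 * (x₁ : ℤ) + x₂ - N) *
          (1 - (1 + q⁻¹) * θ ^ 2 * q ^ (-(x₂ : ℤ)) + θ ^ 2
            + q⁻¹ * θ ^ 2 * q ^ (-((x₁ : ℤ) + x₂)))) * Kq q n₁ n₂ x₁ x₂ θ φ N
      + φ ^ 2 * q ^ ((x₁ : ℤ) + x₂ - N - 1) * (1 - q ^ x₁) * (1 - θ ^ 2 * q ^ (-(x₂ : ℤ) - 1)) *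
        Kq q n₁ n₂ ((x₁ : ℤ) - 1) ((x₂ : ℤ) + 1) θ φ N
      + θ ^ 2 * φ ^ 2 * q ^ (2 * (x₁ : ℤ) - N - 1) * (1 - q ^ x₂) *
        Kq q n₁ n₂ ((x₁ : ℤ) + 1) ((x₂ : ℤ) - 1) θ φ N
      + q ^ x₁ * (1 - q ^ x₂) * (1 - φ ^ 2 * q ^ ((x₁ : ℤ) + x₂ - N - 1)) *
        Kq q n₁ n₂ x₁ ((x₂ : ℤ) - 1) θ φ N
      - φ ^ 2 * q ^ (x₁ + x₂) * (1 - q ^ ((x₁ : ℤ) + x₂ - N)) * (1 - θ ^ 2 * q ^ (-(x₂ : ℤ) - 1)) *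
        Kq q n₁ n₂ x₁ ((x₂ : ℤ) + 1) θ φ N
      + (1 - q ^ x₁) * (1 - φ ^ 2 * q ^ ((x₁ : ℤ) + x₂ - N - 1)) *
        Kq q n₁ n₂ ((x₁ : ℤ) - 1) x₂ θ φ N
      - θ ^ 2 * φ ^ 2 * q ^ ((x₁ : ℤ) - 1) * (1 - q ^ ((x₁ : ℤ) + x₂ - N)) *
        Kq q n₁ n₂ ((x₁ : ℤ) + 1) x₂ θ φ N := by
  have hq := hq0.ne'
  have ha : q ^ x₁ ≠ 0 := pow_ne_zero _ hq
  have hb : q ^ x₂ ≠ 0 := pow_ne_zero _ hq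
  have hM : q ^ N ≠ 0 := pow_ne_zero _ hq
  have hQ : q ^ n₁ ≠ 0 := pow_ne_zero _ hq
  have hp : (θ ^ 2)⁻¹ * θ ^ 2 = 1 := inv_mul_cancel₀ (pow_ne_zero 2 hθ)
  have e := Kq_shift q hq0 n₁ n₂ x₁ x₂ N θ φ
  have e0 := e 0 0
  have e1 := e (-1) 1
  have e2 := e 1 (-1)
  have e3 := e 0 (-1)
  have e4 := e 0 1
  have e5 := e (-1) 0
  have e6 := e 1 0
  clear e
  simp only [add_zero, zero_add, neg_neg, neg_zero, zpow_zero, zpow_one, mul_one, zpow_neg,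
    zero_sub, neg_add_cancel, add_neg_cancel, ← sub_eq_add_neg, ← div_eq_mul_inv] at e0 e1 e2 e3 e4 e5 e6
  rw [e0, e1, e2, e3, e4, e5, e6]
  have hXY : q ^ x₁ * (q ^ x₁)⁻¹ = 1 := mul_inv_cancel₀ ha
  have hZS : (q ^ x₁ * q ^ x₂)⁻¹ * (q ^ x₁ * q ^ x₂) = 1 := inv_mul_cancel₀ (mul_ne_zero ha hb)
  have hVU : q ^ x₁ * q ^ x₂ / q ^ n₁ * (q ^ n₁ / (q ^ x₁ * q ^ x₂)) = 1 := by field_simp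
  have hD := qKrawSum_difference hq0 hq1 n₁ (θ ^ 2)⁻¹ (q ^ x₁ * q ^ x₂)⁻¹ hXY
  have hL := qKrawSum_lower (q := q) n₁ (θ ^ 2)⁻¹ hXY hZS
  have hR := qKrawSum_raise hq0 hq1 n₁ hp hXY hZS
  have hB := qKrawSum_difference hq0 hq1 n₂ (φ ^ 2)⁻¹ (q ^ n₁ / q ^ N) hVU
  clear e0 e1 e2 e3 e4 e5 e6
  generalize qKrawSum q n₁ (θ ^ 2)⁻¹ (q ^ x₁)⁻¹ (q ^ x₁ * q ^ x₂)⁻¹ = A₀ at hD hL hR ⊢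
  generalize qKrawSum q n₁ (θ ^ 2)⁻¹ ((q ^ x₁)⁻¹ * q) (q ^ x₁ * q ^ x₂)⁻¹ = A₁ at hD hL hR ⊢
  generalize qKrawSum q n₁ (θ ^ 2)⁻¹ ((q ^ x₁)⁻¹ / q) (q ^ x₁ * q ^ x₂)⁻¹ = A₂ at hD hL hR ⊢
  generalize qKrawSum q n₁ (θ ^ 2)⁻¹ (q ^ x₁)⁻¹ ((q ^ x₁ * q ^ x₂)⁻¹ * q) = A₃ at hD hL hR ⊢
  generalize qKrawSum q n₁ (θ ^ 2)⁻¹ (q ^ x₁)⁻¹ ((q ^ x₁ * q ^ x₂)⁻¹ / q) = A₄ at hD hL hR ⊢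
  generalize qKrawSum q n₁ (θ ^ 2)⁻¹ ((q ^ x₁)⁻¹ * q) ((q ^ x₁ * q ^ x₂)⁻¹ * q) = A₅ at hD hL hR ⊢
  generalize qKrawSum q n₁ (θ ^ 2)⁻¹ ((q ^ x₁)⁻¹ / q) ((q ^ x₁ * q ^ x₂)⁻¹ / q) = A₆ at hD hL hR ⊢
  generalize qKrawSum q n₂ (φ ^ 2)⁻¹ (q ^ n₁ / (q ^ x₁ * q ^ x₂)) (q ^ n₁ / q ^ N) = B₀ at hB ⊢
  generalize qKrawSum q n₂ (φ ^ 2)⁻¹ ((q ^ n₁ / (q ^ x₁ * q ^ x₂)) * q) (q ^ n₁ / q ^ N) = B₁ at hB ⊢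
  generalize qKrawSum q n₂ (φ ^ 2)⁻¹ ((q ^ n₁ / (q ^ x₁ * q ^ x₂)) / q) (q ^ n₁ / q ^ N) = B₂ at hB ⊢
  generalize (-1 : ℝ) ^ n₁ * q ^ (n₁ * (n₁ - 1) / 2) *
    ((-1 : ℝ) ^ n₂ * q ^ (n₂ * (n₂ - 1) / 2)) = c
  simp only [zpow_add₀ hq, zpow_sub₀ hq, zpow_neg, zpow_natCast, zpow_one, two_mul, pow_add]
  generalize q ^ x₁ = a at *
  generalize q ^ x₂ = b at *
  generalize q ^ N = M at *
  generalize q ^ n₁ = Q at *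
  generalize q ^ n₂ = R at *
  linear_combination (norm := (field_simp; ring))
    (-c * φ ^ 2 * (a * b) / (M * q) * θ ^ 2 * B₀) * hD -
    c * (1 - φ ^ 2 * (a * b) / (M * q)) * B₁ * hL +
    c * φ ^ 2 * (1 - a * b / M) * B₂ * hR - c * φ ^ 2 * Q * A₀ * hB
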